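/- Let B : [0,∞) → ℝ be a continuous function and let ℓ : ℝ × [0,∞) → [0,∞) be a jointly continuous function such that for every y ∈ ℝ and every t ≥ 0, ℓ(y,t) = lim_{ε→0⁺} (2ε)⁻¹ · Leb{u ∈ [0,t] : |B(u) − y| < ε}. Set K(u) := (B(u), ℓ(B(u), u)). Then for every t ≥ 0, {K(u) : u ∈ [0,t]} = {(y,s) ∈ ℝ × [0,∞) : y ∈ B([0,t]) and 0 ≤ s ≤ ℓ(y,t)}. That is, at time t the path K has traced out exactly the 'wall' of height ℓ(y,t) above each point y visited by B before time t. -/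

import Mathlib

open MeasureTheory Filter Set

/-- The occupation-density property: `ℓ y t` is the limit as `ε → 0⁺` of
`(2ε)⁻¹ · Leb {u ∈ [0,t] : |B u − y| < ε}`. -/
def OccupationDensity (B : ℝ → ℝ) (ℓ : ℝ → ℝ → ℝ) : Prop :=
  ∀ y t : ℝ, 0 ≤ t →
    Tendsto (fun ε : ℝ =>
        (volume {u ∈ Icc (0:ℝ) t | |B u - y| < ε}).toReal / (2 * ε))
      (nhdsWithin 0 (Ioi 0)) (nhds (ℓ y t))

namespace OccupationDensity

variable {B : ℝ → ℝ} {ℓ : ℝ → ℝ → ℝ} {y c d : ℝ}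

theorem apply_zero (hocc : OccupationDensity B ℓ) (y : ℝ) : ℓ y 0 = 0 := by
  refine tendsto_nhds_unique (hocc y 0 le_rfl) (tendsto_const_nhds.congr fun ε => ?_)
  have h : volume {u ∈ Icc (0:ℝ) 0 | |B u - y| < ε} = 0 := by
    refine measure_mono_null (fun u hu => ?_) (Real.volume_singleton (a := 0))
    simpa using hu.1
  rw [h, ENNReal.toReal_zero, zero_div]

theorem mono (hocc : OccupationDensity B ℓ) (hc : 0 ≤ c) (hcd : c ≤ d) : ℓ y c ≤ ℓ y d := by
  refine le_of_tendsto_of_tendsto (hocc y c hc) (hocc y d (hc.trans hcd)) ?_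
  filter_upwards [self_mem_nhdsWithin] with ε hε
  have hε : 0 < ε := hε
  have hfin : volume {u ∈ Icc (0:ℝ) d | |B u - y| < ε} ≠ ⊤ :=
    measure_ne_top_of_subset (sep_subset _ _) (by simp)
  gcongr

/-- The occupation density at a level does not grow on a closed interval avoiding that level. -/
theorem eq_of_forall_Icc_ne (hocc : OccupationDensity B ℓ) (hB : ContinuousOn B (Ici 0))
    (hc : 0 ≤ c) (hcd : c ≤ d) (hne : ∀ u ∈ Icc c d, B u ≠ y) : ℓ y c = ℓ y d := by
  have hcont : ContinuousOn (fun u => |B u - y|) (Icc c d) :=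
    ((hB.mono fun u hu => hc.trans hu.1).sub continuousOn_const).abs
  obtain ⟨m, hm, hmin⟩ := isCompact_Icc.exists_isMinOn (nonempty_Icc.2 hcd) hcont
  have hδ : 0 < |B m - y| := abs_pos.2 (sub_ne_zero.2 (hne m hm))
  refine tendsto_nhds_unique (hocc y c hc) ((hocc y d (hc.trans hcd)).congr' ?_)
  filter_upwards [mem_nhdsWithin_of_mem_nhds (Iio_mem_nhds hδ)] with ε hε
  have hset : {u ∈ Icc (0:ℝ) d | |B u - y| < ε} = {u ∈ Icc (0:ℝ) c | |B u - y| < ε} := by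
    ext u
    refine ⟨fun ⟨hu, hlt⟩ => ⟨⟨hu.1, ?_⟩, hlt⟩, fun ⟨hu, hlt⟩ => ⟨⟨hu.1, hu.2.trans hcd⟩, hlt⟩⟩
    by_contra! hcu
    exact (hlt.trans hε).not_ge (hmin ⟨hcu.le, hu.2⟩)
  rw [hset]

/-- The occupation density at a level does not grow on an open interval avoiding that level. -/
theorem eq_of_forall_Ioo_ne (hocc : OccupationDensity B ℓ) (hB : ContinuousOn B (Ici 0))
    (hℓ : ContinuousOn (ℓ y) (Ici 0)) (hc : 0 ≤ c) (hcd : c ≤ d)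
    (hne : ∀ u ∈ Ioo c d, B u ≠ y) : ℓ y c = ℓ y d := by
  obtain rfl | hlt := hcd.eq_or_lt
  · rfl
  obtain ⟨m, hm⟩ := nonempty_Ioo.2 hlt
  have hconst : EqOn (ℓ y) (fun _ => ℓ y m) (Ioo c d) := by
    intro u hu
    rcases le_total u m with hum | hmu
    · exact hocc.eq_of_forall_Icc_ne hB (hc.trans hu.1.le) hum
        fun v hv => hne v ⟨hu.1.trans_le hv.1, hv.2.trans_lt hm.2⟩
    · exact (hocc.eq_of_forall_Icc_ne hB (hc.trans hm.1.le) hmu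
        fun v hv => hne v ⟨hm.1.trans_le hv.1, hv.2.trans_lt hu.2⟩).symm
  have heq : EqOn (ℓ y) (fun _ => ℓ y m) (Icc c d) :=
    hconst.of_subset_closure (hℓ.mono fun u hu => hc.trans hu.1) continuousOn_const
      Ioo_subset_Icc_self (closure_Ioo hlt.ne).ge
  exact (heq (left_mem_Icc.2 hcd)).trans (heq (right_mem_Icc.2 hcd)).symm

end OccupationDensity

theorem bricklayer_wall_description
    (B : ℝ → ℝ) (ℓ : ℝ → ℝ → ℝ)
    (hB : ContinuousOn B (Ici 0))
    (hℓnn : ∀ y t : ℝ, 0 ≤ t → 0 ≤ ℓ y t)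
    (hℓcont : ContinuousOn (fun p : ℝ × ℝ => ℓ p.1 p.2) (univ ×ˢ Ici 0))
    (hocc : OccupationDensity B ℓ) :
    ∀ t : ℝ, 0 ≤ t →
      (fun u => (B u, ℓ (B u) u)) '' Icc 0 t =
        {p : ℝ × ℝ | p.1 ∈ B '' Icc 0 t ∧ 0 ≤ p.2 ∧ p.2 ≤ ℓ p.1 t} := by
  intro t ht
  apply Subset.antisymm
  · rintro _ ⟨u, hu, rfl⟩
    exact ⟨mem_image_of_mem B hu, hℓnn _ _ hu.1, hocc.mono hu.1 hu.2⟩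
  rintro ⟨y, s⟩ ⟨⟨w, hw, hwy⟩, hs0, hst⟩
  have hℓ : ContinuousOn (ℓ y) (Ici 0) :=
    hℓcont.comp (f := fun u => (y, u)) (by fun_prop) fun u hu => ⟨mem_univ _, hu⟩
  obtain ⟨v, hv, hvs⟩ : s ∈ ℓ y '' Icc 0 t :=
    intermediate_value_Icc ht (hℓ.mono Icc_subset_Ici_self)
      ⟨(hocc.apply_zero y).trans_le hs0, hst⟩
  have hcompact : ∀ a b : ℝ, 0 ≤ a → IsCompact (Icc a b ∩ B ⁻¹' {y}) := fun a b ha =>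
    isCompact_Icc.of_isClosed_subset
      ((hB.mono fun u hu => ha.trans hu.1).preimage_isClosed_of_isClosed isClosed_Icc
        isClosed_singleton) inter_subset_left
  suffices h : ∃ u ∈ Icc 0 t, B u = y ∧ ℓ y u = s by
    obtain ⟨u, hu, rfl, rfl⟩ := h
    exact ⟨u, hu, rfl⟩
  rcases le_total w v with hwv | hvw
  · obtain ⟨a, ⟨ha, hay⟩, hmax⟩ := (hcompact 0 v le_rfl).exists_isGreatest ⟨w, ⟨hw.1, hwv⟩, hwy⟩
    refine ⟨a, ⟨ha.1, ha.2.trans hv.2⟩, hay, ?_⟩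
    rw [← hvs]
    exact hocc.eq_of_forall_Ioo_ne hB hℓ ha.1 ha.2
      fun u hu huy => hu.1.not_ge (hmax ⟨⟨ha.1.trans hu.1.le, hu.2.le⟩, huy⟩)
  · obtain ⟨b, ⟨hb, hby⟩, hmin⟩ := (hcompact v t hv.1).exists_isLeast ⟨w, ⟨hvw, hw.2⟩, hwy⟩
    refine ⟨b, ⟨hv.1.trans hb.1, hb.2⟩, hby, ?_⟩
    rw [← hvs]
    exact (hocc.eq_of_forall_Ioo_ne hB hℓ hv.1 hb.1
      fun u hu huy => hu.2.not_ge (hmin ⟨⟨hu.1.le, hu.2.le.trans hb.2⟩, huy⟩)).symm
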